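/- arXiv:1806.02513 — 2 statements merged into one kernel-verified Lean document; each statement's English description precedes it below -/
import Mathlib

section
/- Let d ≥ 1, let ζ ∈ ℂ be a primitive d-th root of unity, let a ≥ 1, let s : Fin a → ℂ^× be injective, and let τ be a permutation of Fin a satisfying s(τ(α)) = ζ · s(α) for all α. Then: (i) d divides a; (ii) every cycle of τ has length d, so τ is a product of a/d disjoint d-cycles and τ has order d; (iii) τ is the unique permutation of Fin a satisfying the identity s(τ(α)) = ζ · s(α) for all α; (iv) the image of s is the disjoint union of a/d sets of the form {t, ζt, ζ²t, …, ζ^{d−1}t} with t ∈ ℂ^×. -/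
/-!
STATEMENT 2: ζ a primitive d-th root of unity, s : Fin a → ℂ^× injective, τ a permutation
with s(τ α) = ζ · s(α).  Then d ∣ a; every cycle of τ has length d (so τ is a product of
a/d disjoint d-cycles and has order d); τ is unique with this property; and the image of s
is the disjoint union of a/d sets {t, ζt, …, ζ^{d-1}t}.
-/

/-- The cycles of `τ`, each listed from a chosen base point. -/
noncomputable def cycleEnum {β : Type*} (τ : Equiv.Perm β) (d : ℕ)
    (p : Quotient (Equiv.Perm.SameCycle.setoid τ) × Fin d) : β :=
  (τ ^ (p.2 : ℕ)) p.1.out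

theorem cycleEnum_bijective {β : Type*} [Finite β] {τ : Equiv.Perm β} {d : ℕ} (hd : 1 ≤ d)
    (h : ∀ x, Function.minimalPeriod τ x = d) : Function.Bijective (cycleEnum τ d) := by
  constructor
  · rintro ⟨p, i⟩ ⟨q, j⟩ hpq
    simp only [cycleEnum] at hpq
    have hc : τ.SameCycle p.out q.out := by
      rw [← Equiv.Perm.sameCycle_pow_left (n := i), hpq, Equiv.Perm.sameCycle_pow_left]
    have hpq' : p = q := Quotient.out_equiv_out.mp hc
    subst hpq'
    have hij : (i : ℕ) = j := by
      refine Function.iterate_injOn_Iio_minimalPeriod (f := τ) (x := p.out) ?_ ?_ ?_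
      · simp [h]
      · simp [h]
      · simpa [Equiv.Perm.iterate_eq_pow] using hpq
    rw [Fin.ext hij]
  · intro x
    have hc : τ.SameCycle (Quotient.mk (Equiv.Perm.SameCycle.setoid τ) x).out x :=
      Quotient.mk_out (s := Equiv.Perm.SameCycle.setoid τ) x
    obtain ⟨n, hn⟩ := hc.exists_nat_pow_eq
    refine ⟨⟨Quotient.mk _ x, ⟨n % d, Nat.mod_lt _ hd⟩⟩, ?_⟩
    have hmod := Function.iterate_mod_minimalPeriod_eq (f := τ) (n := n)
      (x := (Quotient.mk (Equiv.Perm.SameCycle.setoid τ) x).out)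
    rw [h, Equiv.Perm.iterate_eq_pow, Equiv.Perm.iterate_eq_pow, hn] at hmod
    exact hmod

theorem card_quotient_sameCycle_mul {β : Type*} [Finite β] {τ : Equiv.Perm β} {d : ℕ}
    (hd : 1 ≤ d) (h : ∀ x, Function.minimalPeriod τ x = d) :
    Nat.card (Quotient (Equiv.Perm.SameCycle.setoid τ)) * d = Nat.card β := by
  rw [← Nat.card_congr (Equiv.ofBijective _ (cycleEnum_bijective hd h)), Nat.card_prod,
    Nat.card_fin]

theorem orderOf_eq_of_minimalPeriod_eq {β : Type*} [Nonempty β] {τ : Equiv.Perm β} {d : ℕ}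
    (h : ∀ x, Function.minimalPeriod τ x = d) : orderOf τ = d := by
  refine Nat.dvd_right_iff_eq.mp fun n => ?_
  rw [orderOf_dvd_iff_pow_eq_one, Equiv.Perm.ext_iff]
  have key (x : β) : (τ ^ n) x = (1 : Equiv.Perm β) x ↔ d ∣ n := by
    rw [← h x, ← Function.isPeriodicPt_iff_minimalPeriod_dvd, Function.IsPeriodicPt,
      Equiv.Perm.iterate_eq_pow]
    rfl
  simp only [key, forall_const]

theorem cycleType_eq_replicate_of_minimalPeriod_eq {β : Type*} [Fintype β] [DecidableEq β]
    {τ : Equiv.Perm β} {d : ℕ} (hd : 2 ≤ d) (h : ∀ x, Function.minimalPeriod τ x = d) :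
    τ.cycleType = Multiset.replicate (Fintype.card β / d) d := by
  have hmem : ∀ c ∈ τ.cycleType, c = d := by
    intro c hc
    rw [Equiv.Perm.cycleType_def, Multiset.mem_map] at hc
    obtain ⟨σ, hσ, rfl⟩ := hc
    have hσ' := Finset.mem_val.mp hσ
    have hcyc := (Equiv.Perm.mem_cycleFactorsFinset_iff.mp hσ').1
    obtain ⟨x, hx⟩ := hcyc.nonempty_support
    have hσx := Equiv.Perm.cycle_is_cycleOf hx hσ'
    rw [Function.comp_apply, ← hcyc.orderOf]
    refine Nat.dvd_right_iff_eq.mp fun n => ?_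
    rw [orderOf_dvd_iff_pow_eq_one, hcyc.pow_eq_one_iff' (Equiv.Perm.mem_support.mp hx), hσx,
      Equiv.Perm.cycleOf_pow_apply_self, ← h x, ← Function.isPeriodicPt_iff_minimalPeriod_dvd,
      Function.IsPeriodicPt, Equiv.Perm.iterate_eq_pow]
    rfl
  have hsupp : τ.support = Finset.univ := by
    ext x
    simp only [Equiv.Perm.mem_support, Finset.mem_univ, iff_true]
    intro hx
    have := Function.minimalPeriod_eq_one_iff_isFixedPt.mpr hx
    rw [h x] at this
    omega
  have hrep := Multiset.eq_replicate_card.mpr hmem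
  have hsum := τ.sum_cycleType
  rw [hrep, hsupp, Multiset.sum_replicate, Finset.card_univ, smul_eq_mul] at hsum
  rw [← hsum, Nat.mul_div_cancel _ (by omega)]
  exact hrep

theorem perm_of_primitive_root_scaling
    (d a : ℕ) (hd : 1 ≤ d) (ha : 1 ≤ a)
    (ζ : ℂ) (hζ : IsPrimitiveRoot ζ d)
    (s : Fin a → ℂˣ) (hs : Function.Injective s)
    (τ : Equiv.Perm (Fin a))
    (hτ : ∀ α : Fin a, (s (τ α) : ℂ) = ζ * (s α : ℂ)) :
    -- (i) d divides a
    d ∣ a ∧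
    -- (ii) every cycle of τ has length d ...
    (∀ α : Fin a, Function.minimalPeriod (⇑τ) α = d) ∧
    orderOf τ = d ∧
    -- ... and τ is a product of a/d disjoint d-cycles
    (2 ≤ d → τ.cycleType = Multiset.replicate (a / d) d) ∧
    -- (iii) τ is the unique permutation satisfying the identity
    (∀ τ' : Equiv.Perm (Fin a), (∀ α : Fin a, (s (τ' α) : ℂ) = ζ * (s α : ℂ)) → τ' = τ) ∧
    -- (iv) the image of s is the disjoint union of a/d sets {t, ζt, ζ²t, …, ζ^{d-1}t}
    (∃ t : Fin (a / d) → ℂˣ,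
      (∀ j k : Fin (a / d), j ≠ k →
        Disjoint (Set.range fun i : Fin d => ζ ^ (i : ℕ) * ((t j : ℂ)))
          (Set.range fun i : Fin d => ζ ^ (i : ℕ) * ((t k : ℂ)))) ∧
      (Set.range fun α : Fin a => (s α : ℂ)) =
        ⋃ j : Fin (a / d), Set.range fun i : Fin d => ζ ^ (i : ℕ) * ((t j : ℂ))) := by
  have hpow (n : ℕ) (α : Fin a) : (s ((τ ^ n) α) : ℂ) = ζ ^ n * (s α : ℂ) := by
    induction n with
    | zero => simp
    | succ n ih => rw [pow_succ', Equiv.Perm.mul_apply, hτ, ih, pow_succ', mul_assoc]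
  have hper (α : Fin a) : Function.minimalPeriod τ α = d := by
    refine Nat.dvd_right_iff_eq.mp fun n => ?_
    rw [← Function.isPeriodicPt_iff_minimalPeriod_dvd, ← hζ.pow_eq_one_iff_dvd,
      Function.IsPeriodicPt, Equiv.Perm.iterate_eq_pow, Function.IsFixedPt, ← hs.eq_iff,
      ← Units.val_inj, hpow, mul_eq_right₀ (s α).ne_zero]
  have hcard := card_quotient_sameCycle_mul hd hper
  rw [Nat.card_fin] at hcard
  have hne : Nonempty (Fin a) := ⟨⟨0, ha⟩⟩
  refine ⟨⟨_, (mul_comm _ _).trans hcard |>.symm⟩, hper, orderOf_eq_of_minimalPeriod_eq hper,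
    fun h2 => ?_, fun τ' hτ' => ?_, ?_⟩
  · simpa using cycleType_eq_replicate_of_minimalPeriod_eq h2 hper
  · ext1 α
    exact hs (Units.ext ((hτ' α).trans (hτ α).symm))
  · have hbij := cycleEnum_bijective hd hper
    let e : Fin (a / d) ≃ Quotient (Equiv.Perm.SameCycle.setoid τ) :=
      (Finite.equivFinOfCardEq (Nat.eq_div_of_mul_eq_left (by omega) hcard)).symm
    have hrange (j : Fin (a / d)) (i : Fin d) :
        (s (cycleEnum τ d (e j, i)) : ℂ) = ζ ^ (i : ℕ) * (s (e j).out : ℂ) := hpow _ _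
    refine ⟨fun j => s (e j).out, fun j k hjk => ?_, ?_⟩
    · rw [Set.disjoint_left]
      rintro _ ⟨i, rfl⟩ ⟨i', h⟩
      simp only [← hrange] at h
      have h' := hbij.1 (hs (Units.ext h))
      exact hjk (e.injective (Prod.ext_iff.mp h').1.symm)
    · ext z
      simp only [Set.mem_range, Set.mem_iUnion, ← hrange]
      constructor
      · rintro ⟨α, rfl⟩
        obtain ⟨⟨q, i⟩, rfl⟩ := hbij.2 α
        exact ⟨e.symm q, i, by rw [e.apply_symm_apply]⟩
      · rintro ⟨j, i, rfl⟩
        exact ⟨_, rfl⟩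
end

section
/- Let G be a group, N a normal subgroup of G, V a nonzero finite-dimensional complex vector space, and ρ : N → GL(V) an irreducible representation such that for every g ∈ G the conjugate representation m ↦ ρ(g m g⁻¹) is isomorphic to ρ. Then ρ extends to a projective representation of G: there exists a map A : G → GL(V) with A(m) = ρ(m) for all m ∈ N, such that A(g) ρ(m) A(g)⁻¹ = ρ(g m g⁻¹) for all g ∈ G and m ∈ N, and such that for all g, h ∈ G there exists a scalar c(g,h) ∈ ℂ^× with A(gh) = c(g,h) · A(g) A(h). -/
/-!
STATEMENT 7: An irreducible finite-dimensional complex representation ρ of a normal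
subgroup N of G, all of whose G-conjugates are isomorphic to ρ, extends to a projective
representation of G.
-/

/-- **Schur's lemma**: an endomorphism commuting with a family of operators that has no proper
nonzero common invariant subspace is a scalar. -/
theorem Module.End.exists_eq_smul_one_of_commute {K V ι : Type*} [Field K] [IsAlgClosed K]
    [AddCommGroup V] [Module K V] [FiniteDimensional K V] [Nontrivial V]
    (f : ι → Module.End K V)
    (hirr : ∀ W : Submodule K V, (∀ i, ∀ v ∈ W, f i v ∈ W) → W = ⊥ ∨ W = ⊤)
    (u : Module.End K V) (hu : ∀ i, Commute u (f i)) :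
    ∃ c : K, u = c • 1 := by
  obtain ⟨c, hc⟩ := Module.End.exists_eigenvalue u
  have htop : u.eigenspace c = ⊤ := by
    refine (hirr (u.eigenspace c) fun i v hv => ?_).resolve_left hc
    rw [Module.End.mem_eigenspace_iff] at hv ⊢
    rw [← Module.End.mul_apply, (hu i).eq, Module.End.mul_apply, hv, map_smul]
  refine ⟨c, LinearMap.ext fun v => ?_⟩
  have hv : v ∈ u.eigenspace c := htop ▸ Submodule.mem_top
  simpa [Module.End.mem_eigenspace_iff] using hv

theorem invariant_irreducible_extends_projectively
    {G : Type*} [Group G] (N : Subgroup G) (hN : N.Normal)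
    (V : Type*) [AddCommGroup V] [Module ℂ V] [FiniteDimensional ℂ V] [Nontrivial V]
    (ρ : N →* (Module.End ℂ V)ˣ)
    (hirr : ∀ W : Submodule ℂ V,
      (∀ (n : N) (v : V), v ∈ W → (ρ n : Module.End ℂ V) v ∈ W) → W = ⊥ ∨ W = ⊤)
    (hconj : ∀ g : G, ∃ T : V ≃ₗ[ℂ] V, ∀ (n : N) (v : V),
      T ((ρ n : Module.End ℂ V) v) =
        (ρ ⟨g * (n : G) * g⁻¹, hN.conj_mem (n : G) n.2 g⟩ : Module.End ℂ V) (T v)) :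
    ∃ A : G → (Module.End ℂ V)ˣ,
      (∀ n : N, A (n : G) = ρ n) ∧
      (∀ (g : G) (n : N),
        A g * ρ n * (A g)⁻¹ = ρ ⟨g * (n : G) * g⁻¹, hN.conj_mem (n : G) n.2 g⟩) ∧
      (∀ g h : G, ∃ c : ℂˣ,
        (A (g * h) : Module.End ℂ V) =
          (c : ℂ) • ((A g : Module.End ℂ V) * (A h : Module.End ℂ V))) := by
  classical
  have hB : ∀ g : G, ∃ B : (Module.End ℂ V)ˣ, ∀ n : N,
      B * ρ n * B⁻¹ = ρ ⟨g * (n : G) * g⁻¹, hN.conj_mem (n : G) n.2 g⟩ := by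
    intro g
    obtain ⟨T, hT⟩ := hconj g
    refine ⟨LinearMap.GeneralLinearGroup.ofLinearEquiv T, fun n => ?_⟩
    rw [mul_inv_eq_iff_eq_mul]
    exact Units.ext (LinearMap.ext fun v => hT n v)
  choose B hB using hB
  let A : G → (Module.End ℂ V)ˣ := fun g => if h : g ∈ N then ρ ⟨g, h⟩ else B g
  have hA : ∀ (g : G) (n : N),
      A g * ρ n * (A g)⁻¹ = ρ ⟨g * (n : G) * g⁻¹, hN.conj_mem (n : G) n.2 g⟩ := by
    intro g n
    by_cases h : g ∈ N
    · simp only [A, dif_pos h, ← map_inv, ← map_mul]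
      rfl
    · simpa only [A, dif_neg h] using hB g n
  refine ⟨A, fun n => by simp [A], hA, fun g h => ?_⟩
  set u : (Module.End ℂ V)ˣ := (A g * A h)⁻¹ * A (g * h) with hu
  have hcomm : ∀ n : N, Commute u (ρ n) := by
    intro n
    have key : A (g * h) * ρ n * (A (g * h))⁻¹ = A g * (A h * ρ n * (A h)⁻¹) * (A g)⁻¹ := by
      rw [hA, hA, hA]
      congr 2
      group
    rw [mul_inv_eq_iff_eq_mul] at key
    change u * ρ n = ρ n * u
    rw [hu, mul_assoc, key]
    group
  obtain ⟨c, hc⟩ := Module.End.exists_eq_smul_one_of_commute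
    (fun n : N => (ρ n : Module.End ℂ V)) hirr (u : Module.End ℂ V)
    fun n => (hcomm n).map (Units.coeHom (Module.End ℂ V))
  have hc0 : c ≠ 0 := by
    rintro rfl
    exact u.ne_zero (by rw [hc, zero_smul])
  refine ⟨Units.mk0 c hc0, ?_⟩
  have hmul : A (g * h) = A g * A h * u := by rw [hu, mul_inv_cancel_left]
  rw [hmul, Units.val_mul, hc, Units.val_mul, mul_smul_comm, mul_one, Units.val_mk0]
end
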